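/- The multiplier algebra of the Drury–Arveson space on the unit ball of ℂ² is strictly smaller than H^∞ of the ball: the inclusion of the multiplier algebra into the bounded holomorphic functions is not bounded below, i.e. for every c > 0 there exists a holomorphic function φ on B which is a multiplier of H²_2 and satisfies sup_{z∈B} |φ(z)| < c·‖φ‖_mult; consequently there exists a bounded holomorphic function on B that is not a multiplier of H²_2. -/

import Mathlib

open Complex Metric
open scoped ComplexOrder

noncomputable section

/-- The Drury–Arveson weight `α!/|α|!` of a multi-index `α ∈ ℕ²`. -/
def daWeight (α : Fin 2 → ℕ) : ℝ :=
  ((∏ i, Nat.factorial (α i) : ℕ) : ℝ) / ((Nat.factorial (∑ i, α i) : ℕ) : ℝ)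

/-- `a` is the family of Taylor coefficients of `f` on the unit ball of `ℂ²`. -/
def IsCoeffDA (f : EuclideanSpace ℂ (Fin 2) → ℂ) (a : (Fin 2 → ℕ) → ℂ) : Prop :=
  ∀ w ∈ ball (0 : EuclideanSpace ℂ (Fin 2)) 1,
    HasSum (fun α : Fin 2 → ℕ => a α * ∏ i, w i ^ α i) (f w)

/-- Membership in the Drury–Arveson space `H²₂`, in terms of the coefficients. -/
def DASummable (a : (Fin 2 → ℕ) → ℂ) : Prop :=
  Summable fun α : Fin 2 → ℕ => ‖a α‖ ^ 2 * daWeight α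

/-- The squared Drury–Arveson norm, in terms of the coefficients. -/
def daNormSq (a : (Fin 2 → ℕ) → ℂ) : ℝ :=
  ∑' α : Fin 2 → ℕ, ‖a α‖ ^ 2 * daWeight α

/-- `φ` is a multiplier of the Drury–Arveson space `H²₂`. -/
def IsDAMultiplier (φ : EuclideanSpace ℂ (Fin 2) → ℂ) : Prop :=
  ∀ (f : EuclideanSpace ℂ (Fin 2) → ℂ) (a : (Fin 2 → ℕ) → ℂ),
    IsCoeffDA f a → DASummable a →
    ∃ b : (Fin 2 → ℕ) → ℂ, IsCoeffDA (fun w => φ w * f w) b ∧ DASummable b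

/-- The set of values `‖φ f‖` as `f` ranges over the unit ball of `H²₂`; the multiplier
norm of `φ` is its supremum. -/
def multNormSet (φ : EuclideanSpace ℂ (Fin 2) → ℂ) : Set ℝ :=
  {r : ℝ | ∃ (f : EuclideanSpace ℂ (Fin 2) → ℂ) (a b : (Fin 2 → ℕ) → ℂ),
    IsCoeffDA f a ∧ DASummable a ∧ daNormSq a ≤ 1 ∧
    IsCoeffDA (fun w => φ w * f w) b ∧ DASummable b ∧ r = Real.sqrt (daNormSq b)}

lemma hs_congr {ι : Type} {f g : ι → ℂ} {s : ℂ} (h : HasSum g s) (e : ∀ i, f i = g i) :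
    HasSum f s := by
  have : f = g := funext e
  rwa [this]

lemma daWeight_eq (α : Fin 2 → ℕ) :
    daWeight α = 1 / ((α 0 + α 1).choose (α 0) : ℝ) := by
  have h := Nat.add_choose_mul_factorial_mul_factorial (α 0) (α 1)
  rw [Nat.choose_symm_add.symm] at h
  have h' : (((α 0 + α 1).choose (α 0) : ℕ) : ℝ) * (α 0).factorial * (α 1).factorial
      = (α 0 + α 1).factorial := by exact_mod_cast h
  have h1 : (0 : ℝ) < ((α 0).factorial : ℝ) := by exact_mod_cast Nat.factorial_pos _
  have h2 : (0 : ℝ) < ((α 1).factorial : ℝ) := by exact_mod_cast Nat.factorial_pos _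
  have h3 : (0 : ℝ) < ((α 0 + α 1).choose (α 0) : ℝ) := by
    exact_mod_cast Nat.choose_pos (Nat.le_add_right _ _)
  unfold daWeight
  rw [Fin.prod_univ_two, Fin.sum_univ_two, ← h', Nat.cast_mul]
  field_simp

lemma daWeight_nonneg (α : Fin 2 → ℕ) : 0 ≤ daWeight α := by
  unfold daWeight; positivity

def shiftDA (n : ℕ) (α : Fin 2 → ℕ) : Fin 2 → ℕ := fun i => α i + n

lemma shiftDA_inj (n : ℕ) : Function.Injective (shiftDA n) := by
  intro a b h
  funext i
  have := congrFun h i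
  simpa [shiftDA] using this

lemma choose_mono_aux (m a n : ℕ) : m.choose a ≤ (m + n).choose (a + n) := by
  induction n with
  | zero => simp
  | succ n ih =>
    refine ih.trans ?_
    rw [← add_assoc, ← add_assoc, Nat.choose_succ_succ]
    exact Nat.le_add_right _ _

lemma daWeight_shift_le (n : ℕ) (α : Fin 2 → ℕ) : daWeight (shiftDA n α) ≤ daWeight α := by
  rw [daWeight_eq, daWeight_eq]
  have h3 : (0 : ℝ) < ((α 0 + α 1).choose (α 0) : ℝ) := by
    exact_mod_cast Nat.choose_pos (Nat.le_add_right _ _)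
  apply one_div_le_one_div_of_le h3
  norm_cast
  refine (choose_mono_aux _ _ n).trans ?_
  exact Nat.choose_le_choose _ (by simp only [shiftDA]; omega)

lemma central_bound (n : ℕ) : (2 * n + 1) * (n.centralBinom) ^ 2 ≤ 16 ^ n := by
  induction n with
  | zero => simp
  | succ n ih =>
    have h := Nat.succ_mul_centralBinom_succ n
    have hp : 0 < (n + 1) ^ 2 := by positivity
    refine Nat.le_of_mul_le_mul_left ?_ hp
    calc (n + 1) ^ 2 * ((2 * (n + 1) + 1) * ((n + 1).centralBinom) ^ 2)
        = (2 * n + 3) * ((n + 1) * (n + 1).centralBinom) ^ 2 := by ring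
      _ = (4 * (2 * n + 3) * (2 * n + 1)) * ((2 * n + 1) * n.centralBinom ^ 2) := by
          rw [h]; ring
      _ ≤ (16 * (n + 1) ^ 2) * 16 ^ n := by
          apply Nat.mul_le_mul _ ih
          nlinarith
      _ = (n + 1) ^ 2 * 16 ^ (n + 1) := by ring

/-- Lower bound for the norm of `(2 z₁ z₂)^(16^k)`. -/
lemma weight_lower (k : ℕ) (α : Fin 2 → ℕ) (h0 : α 0 = 16 ^ k) (h1 : α 1 = 16 ^ k) :
    (4 : ℝ) ^ k ≤ ((2 : ℝ) ^ (16 ^ k)) ^ 2 * daWeight α := by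
  rw [daWeight_eq, h0, h1]
  generalize hn : 16 ^ k = n
  have hc : (n + n).choose n = n.centralBinom := by
    rw [Nat.centralBinom_eq_two_mul_choose, two_mul]
  rw [hc]
  have hpos : (0 : ℝ) < n.centralBinom := by exact_mod_cast n.centralBinom_pos
  rw [mul_one_div, le_div_iff₀ hpos]
  have hb : ((2 * n + 1 : ℝ)) * (n.centralBinom : ℝ) ^ 2 ≤ 16 ^ n := by
    exact_mod_cast central_bound n
  have hn' : (n : ℝ) = ((4 : ℝ) ^ k) ^ 2 := by
    rw [← hn, ← pow_mul, mul_comm, pow_mul]; norm_num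
  refine le_of_sq_le_sq ?_ (by positivity)
  have e : (((2 : ℝ) ^ n) ^ 2) ^ 2 = 16 ^ n := by
    rw [← pow_mul, ← pow_mul, mul_comm, mul_assoc, pow_mul]; norm_num [pow_mul]
  rw [e, mul_pow, ← hn']
  nlinarith [sq_nonneg (n.centralBinom : ℝ), (Nat.cast_nonneg n : (0:ℝ) ≤ n)]

lemma one_dim_unique (c : ℕ → ℂ) (r : ℝ) (hr : 0 < r)
    (h : ∀ z : ℂ, ‖z‖ < r → HasSum (fun n => c n * z ^ n) 0) : c = 0 := by
  have hf : HasFPowerSeriesAt (fun _ : ℂ => (0 : ℂ)) (FormalMultilinearSeries.ofScalars ℂ c) 0 := by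
    rw [hasFPowerSeriesAt_iff]
    filter_upwards [Metric.ball_mem_nhds (0 : ℂ) hr] with z hz
    have := h z (by simpa using hz)
    simpa [FormalMultilinearSeries.coeff_ofScalars, mul_comm] using this
  have := hf.eq_zero
  funext n
  have h2 : (FormalMultilinearSeries.ofScalars ℂ c).coeff n = 0 := by rw [this]; rfl
  rwa [FormalMultilinearSeries.coeff_ofScalars] at h2

lemma mem_ball_mk (x y : ℂ) (hx : ‖x‖ < 1 / 2) (hy : ‖y‖ < 1 / 2) :
    (!₂[x, y] : EuclideanSpace ℂ (Fin 2)) ∈ ball (0 : EuclideanSpace ℂ (Fin 2)) 1 := by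
  rw [mem_ball_zero_iff, EuclideanSpace.norm_eq, Real.sqrt_lt' one_pos]
  simp only [Fin.sum_univ_two]
  simp
  nlinarith [norm_nonneg x, norm_nonneg y]

lemma coeff_zero (c : (Fin 2 → ℕ) → ℂ) (h : IsCoeffDA (fun _ => 0) c) : c = 0 := by
  have key : ∀ y : ℂ, ‖y‖ < 1 / 2 → ∀ x : ℂ, ‖x‖ < 1 / 2 →
      HasSum (fun p : ℕ × ℕ => c ![p.1, p.2] * (x ^ p.1 * y ^ p.2)) 0 := by
    intro y hy x hx
    have := h _ (mem_ball_mk x y hx hy)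
    rw [← (finTwoArrowEquiv ℕ).symm.hasSum_iff] at this
    convert this using 2
    simp [Function.comp, finTwoArrowEquiv]
  have hsum : ∀ y : ℂ, ‖y‖ < 1 / 2 → ∀ i, Summable (fun j => c ![i, j] * y ^ j) := by
    intro y hy i
    have hx : ‖(1 / 4 : ℂ)‖ < 1 / 2 := by norm_num
    have := (key y hy (1 / 4) hx).summable.prod_factor i
    have h2 := this.mul_left ((4 : ℂ) ^ i)
    refine h2.congr fun j => ?_
    have : (4 : ℂ) ^ i * (1 / 4) ^ i = 1 := by rw [← mul_pow]; norm_num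
    linear_combination (c ![i, j] * y ^ j) * this
  have hz : ∀ y : ℂ, ‖y‖ < 1 / 2 → (fun i => ∑' j, c ![i, j] * y ^ j) = 0 := by
    intro y hy
    refine one_dim_unique _ (1 / 2) (by norm_num) fun x hx => ?_
    refine (key y hy x hx).prod_fiberwise fun i => ?_
    have := (hsum y hy i).hasSum.mul_right (x ^ i)
    refine hs_congr this fun j => ?_
    ring
  have hc : ∀ i, (fun j => c ![i, j]) = 0 := by
    intro i
    refine one_dim_unique _ (1 / 2) (by norm_num) fun y hy => ?_
    have := (hsum y hy i).hasSum
    have e := congrFun (hz y hy) i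
    simp only [Pi.zero_apply] at e
    rwa [e] at this
  funext α
  have := congrFun (hc (α 0)) (α 1)
  have e : ![α 0, α 1] = α := by
    funext i; fin_cases i <;> rfl
  simpa [e] using this

lemma coeff_unique {f : EuclideanSpace ℂ (Fin 2) → ℂ} {a b : (Fin 2 → ℕ) → ℂ}
    (ha : IsCoeffDA f a) (hb : IsCoeffDA f b) : a = b := by
  have := coeff_zero (fun α => a α - b α) (by
    intro w hw
    have := (ha w hw).sub (hb w hw)
    rw [sub_self] at this
    refine hs_congr this fun j => ?_
    ring)
  funext α
  exact sub_eq_zero.mp (congrFun this α)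

lemma norm_prod_lt {w : EuclideanSpace ℂ (Fin 2)}
    (hw : w ∈ ball (0 : EuclideanSpace ℂ (Fin 2)) 1) : ‖2 * (w 0 * w 1)‖ < 1 := by
  rw [mem_ball_zero_iff, EuclideanSpace.norm_eq, Real.sqrt_lt' one_pos] at hw
  simp only [Fin.sum_univ_two] at hw
  simp only [norm_mul, Complex.norm_ofNat]
  nlinarith [sq_nonneg (‖w 0‖ - ‖w 1‖)]

lemma diff_prod : Differentiable ℂ (fun w : EuclideanSpace ℂ (Fin 2) => 2 * (w 0 * w 1)) := by
  fun_prop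

/-- The constant function `1`. -/
lemma coeff_one : IsCoeffDA (fun _ => 1) (Pi.single 0 1) := by
  intro w _
  have := hasSum_single (f := fun α : Fin 2 → ℕ => (Pi.single 0 1 : (Fin 2 → ℕ) → ℂ) α *
    ∏ i, w i ^ α i) 0 (by intro α hα; simp [hα])
  simpa using this

lemma hasSum_one_norm : HasSum (fun α : Fin 2 → ℕ =>
    ‖(Pi.single 0 1 : (Fin 2 → ℕ) → ℂ) α‖ ^ 2 * daWeight α) 1 := by
  have := hasSum_single (f := fun α : Fin 2 → ℕ =>
    ‖(Pi.single 0 1 : (Fin 2 → ℕ) → ℂ) α‖ ^ 2 * daWeight α) 0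
    (by intro α hα; simp [hα])
  simpa [daWeight_eq] using this

/-- Coefficients of `(2 z₁ z₂)^n f`. -/
def shiftCoeff (n : ℕ) (a : (Fin 2 → ℕ) → ℂ) : (Fin 2 → ℕ) → ℂ :=
  Function.extend (shiftDA n) (fun α => 2 ^ n * a α) 0

lemma shiftCoeff_coeff (n : ℕ) {f : EuclideanSpace ℂ (Fin 2) → ℂ} {a : (Fin 2 → ℕ) → ℂ}
    (ha : IsCoeffDA f a) :
    IsCoeffDA (fun w => (2 * (w 0 * w 1)) ^ n * f w) (shiftCoeff n a) := by
  intro w hw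
  have h := (ha w hw).mul_left ((2 * (w 0 * w 1)) ^ n)
  rw [← (shiftDA_inj n).hasSum_iff]
  · refine hs_congr h fun α => ?_
    simp only [Function.comp, shiftCoeff, (shiftDA_inj n).extend_apply, Fin.prod_univ_two, shiftDA]
    ring
  · intro α hα
    have : shiftCoeff n a α = 0 := Function.extend_apply' _ _ _ (fun ⟨b, hb⟩ => hα ⟨b, hb⟩)
    simp [this]

lemma shiftCoeff_norm_hasSum (n : ℕ) (a : (Fin 2 → ℕ) → ℂ) (s : ℝ) :
    HasSum (fun α => ‖shiftCoeff n a α‖ ^ 2 * daWeight α) s ↔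
    HasSum (fun α => ((2 : ℝ) ^ n) ^ 2 * ‖a α‖ ^ 2 * daWeight (shiftDA n α)) s := by
  rw [← (shiftDA_inj n).hasSum_iff]
  · refine iff_of_eq (congrArg (fun g => HasSum g s) ?_)
    funext α
    simp only [Function.comp, shiftCoeff, (shiftDA_inj n).extend_apply]
    simp [mul_pow]
  · intro α hα
    have : shiftCoeff n a α = 0 := Function.extend_apply' _ _ _ (fun ⟨b, hb⟩ => hα ⟨b, hb⟩)
    simp [this]

lemma shiftCoeff_norm (n : ℕ) {a : (Fin 2 → ℕ) → ℂ} (ha : DASummable a) :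
    DASummable (shiftCoeff n a) ∧
      daNormSq (shiftCoeff n a) ≤ ((2 : ℝ) ^ n) ^ 2 * daNormSq a := by
  have hS := ha.hasSum.mul_left (((2 : ℝ) ^ n) ^ 2)
  have hle : ∀ α, ((2 : ℝ) ^ n) ^ 2 * ‖a α‖ ^ 2 * daWeight (shiftDA n α) ≤
      ((2 : ℝ) ^ n) ^ 2 * (‖a α‖ ^ 2 * daWeight α) := by
    intro α
    rw [mul_assoc]
    have := daWeight_shift_le n α
    gcongr
  have hs : Summable (fun α => ((2 : ℝ) ^ n) ^ 2 * ‖a α‖ ^ 2 * daWeight (shiftDA n α)) :=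
    Summable.of_nonneg_of_le
      (fun α => mul_nonneg (by positivity) (daWeight_nonneg _)) hle hS.summable
  have h2 := (shiftCoeff_norm_hasSum n a _).2 hs.hasSum
  refine ⟨h2.summable, ?_⟩
  unfold daNormSq
  rw [h2.tsum_eq]
  exact hasSum_le hle hs.hasSum hS

lemma part_one (c : ℝ) (hc : 0 < c) :
      ∃ (φ : EuclideanSpace ℂ (Fin 2) → ℂ) (Mn : ℝ),
        DifferentiableOn ℂ φ (ball (0 : EuclideanSpace ℂ (Fin 2)) 1) ∧
        IsDAMultiplier φ ∧ IsLUB (multNormSet φ) Mn ∧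
        ∃ s : ℝ, (∀ w ∈ ball (0 : EuclideanSpace ℂ (Fin 2)) 1, ‖φ w‖ ≤ s) ∧
          s < c * Mn := by
  obtain ⟨k, hk⟩ := pow_unbounded_of_one_lt (1 / c) (one_lt_two)
  set n := 16 ^ k with hn
  have hone : DASummable (Pi.single 0 1) := hasSum_one_norm.summable
  have hmem : Real.sqrt (daNormSq (shiftCoeff n (Pi.single 0 1))) ∈
      multNormSet (fun w => (2 * (w 0 * w 1)) ^ n) :=
    ⟨fun _ => 1, Pi.single 0 1, shiftCoeff n (Pi.single 0 1), coeff_one, hone,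
      hasSum_one_norm.tsum_eq.le, shiftCoeff_coeff n coeff_one, (shiftCoeff_norm n hone).1, rfl⟩
  have hbdd : BddAbove (multNormSet (fun w => (2 * (w 0 * w 1)) ^ n)) := by
    refine ⟨2 ^ n, ?_⟩
    rintro r ⟨f, a, b, ha, has, ha1, hb, hbs, rfl⟩
    have : b = shiftCoeff n a := coeff_unique hb (shiftCoeff_coeff n ha)
    rw [this]
    refine Real.sqrt_le_iff.2 ⟨by positivity, ?_⟩
    refine (shiftCoeff_norm n has).2.trans ?_
    exact mul_le_of_le_one_right (by positivity) ha1
  refine ⟨fun w => (2 * (w 0 * w 1)) ^ n, sSup (multNormSet (fun w => (2 * (w 0 * w 1)) ^ n)),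
    (diff_prod.pow n).differentiableOn, ?_, isLUB_csSup ⟨_, hmem⟩ hbdd, 1, ?_, ?_⟩
  · intro f a ha has
    exact ⟨_, shiftCoeff_coeff n ha, (shiftCoeff_norm n has).1⟩
  · intro w hw
    rw [norm_pow]
    exact pow_le_one₀ (norm_nonneg _) (norm_prod_lt hw).le
  · have h1 := le_csSup hbdd hmem
    have h2 : (2 : ℝ) ^ k ≤ Real.sqrt (daNormSq (shiftCoeff n (Pi.single 0 1))) := by
      apply Real.le_sqrt_of_sq_le
      have hw := weight_lower k (shiftDA n 0) (by simp [shiftDA, hn]) (by simp [shiftDA, hn])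
      have e : ((2 : ℝ) ^ k) ^ 2 = 4 ^ k := by rw [← pow_mul, mul_comm, pow_mul]; norm_num
      rw [e]
      refine hw.trans ?_
      have := (shiftCoeff_norm n hone).1.le_tsum (shiftDA n 0)
        (fun j _ => mul_nonneg (by positivity) (daWeight_nonneg _))
      refine le_trans (le_of_eq ?_) this
      simp only [shiftCoeff, (shiftDA_inj n).extend_apply]
      simp [hn]
    have h3 : 1 / c < sSup (multNormSet (fun w => (2 * (w 0 * w 1)) ^ n)) :=
      hk.trans_le (h2.trans h1)
    rwa [div_lt_iff₀' hc] at h3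

def diagDA (k : ℕ) : Fin 2 → ℕ := fun _ => 16 ^ k

lemma diagDA_inj : Function.Injective diagDA := by
  intro a b h
  exact Nat.pow_right_injective (by norm_num : 2 ≤ 16) (congrFun h 0)

def psiCoeff : (Fin 2 → ℕ) → ℂ :=
  Function.extend diagDA (fun k => (1 / 2) ^ k * 2 ^ (16 ^ k)) 0

lemma psi_bound {z : ℂ} (hz : ‖z‖ < 1) (k : ℕ) :
    ‖(1 / 2 : ℂ) ^ k * z ^ (16 ^ k)‖ ≤ (1 / 2 : ℝ) ^ k := by
  rw [norm_mul, norm_pow, norm_pow]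
  have : ‖(1 / 2 : ℂ)‖ = 1 / 2 := by norm_num
  rw [this]
  exact mul_le_of_le_one_right (by positivity) (pow_le_one₀ (norm_nonneg _) hz.le)

lemma psi_hasSum {z : ℂ} (hz : ‖z‖ < 1) :
    HasSum (fun k : ℕ => (1 / 2 : ℂ) ^ k * z ^ (16 ^ k))
      (∑' k : ℕ, (1 / 2 : ℂ) ^ k * z ^ (16 ^ k)) :=
  (Summable.of_norm_bounded summable_geometric_two (psi_bound hz)).hasSum

lemma psi_diff : DifferentiableOn ℂ (fun z : ℂ => ∑' k : ℕ, (1 / 2 : ℂ) ^ k * z ^ (16 ^ k))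
    (ball 0 1) := by
  refine differentiableOn_tsum_of_summable_norm summable_geometric_two ?_ isOpen_ball ?_
  · intro k
    fun_prop
  · intro k z hz
    exact psi_bound (by simpa using hz) k

lemma part_two : ∃ ψ : EuclideanSpace ℂ (Fin 2) → ℂ,
      DifferentiableOn ℂ ψ (ball (0 : EuclideanSpace ℂ (Fin 2)) 1) ∧
      (∃ C : ℝ, ∀ w ∈ ball (0 : EuclideanSpace ℂ (Fin 2)) 1, ‖ψ w‖ ≤ C) ∧
      ¬ IsDAMultiplier ψ := by
  refine ⟨fun w => ∑' k : ℕ, (1 / 2 : ℂ) ^ k * (2 * (w 0 * w 1)) ^ (16 ^ k), ?_, ⟨2, ?_⟩, ?_⟩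
  · refine psi_diff.comp diff_prod.differentiableOn ?_
    intro w hw
    simpa using norm_prod_lt hw
  · intro w hw
    exact tsum_of_norm_bounded hasSum_geometric_two (psi_bound (norm_prod_lt hw))
  · intro hm
    obtain ⟨b, hb, hbs⟩ := hm _ _ coeff_one hasSum_one_norm.summable
    have hp : IsCoeffDA (fun w => (∑' k : ℕ, (1 / 2 : ℂ) ^ k * (2 * (w 0 * w 1)) ^ (16 ^ k)) * 1)
        psiCoeff := by
      intro w hw
      simp only [mul_one]
      rw [← diagDA_inj.hasSum_iff]
      · refine hs_congr (psi_hasSum (norm_prod_lt hw)) fun k => ?_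
        simp only [Function.comp, psiCoeff, diagDA_inj.extend_apply, Fin.prod_univ_two, diagDA]
        ring
      · intro α hα
        have : psiCoeff α = 0 := Function.extend_apply' _ _ _ (fun ⟨b, hb⟩ => hα ⟨b, hb⟩)
        simp [this]
    have e : b = psiCoeff := coeff_unique hb hp
    rw [e] at hbs
    have ht := (hbs.comp_injective diagDA_inj).tendsto_atTop_zero
    obtain ⟨k, hk⟩ := (ht.eventually (gt_mem_nhds (zero_lt_one))).exists
    have hw := weight_lower k (diagDA k) rfl rfl
    simp only [Function.comp, psiCoeff, diagDA_inj.extend_apply] at hk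
    have e2 : ‖(1 / 2 : ℂ) ^ k * 2 ^ (16 ^ k)‖ ^ 2 * daWeight (diagDA k) =
        (1 / 4 : ℝ) ^ k * (((2 : ℝ) ^ (16 ^ k)) ^ 2 * daWeight (diagDA k)) := by
      have : ‖(1 / 2 : ℂ)‖ = 1 / 2 := by norm_num
      rw [norm_mul, norm_pow, norm_pow, this, Complex.norm_ofNat, mul_pow, ← pow_mul, mul_comm k 2,
        pow_mul, mul_assoc]
      norm_num
    rw [e2] at hk
    have h4 : (1 / 4 : ℝ) ^ k * 4 ^ k = 1 := by rw [← mul_pow]; norm_num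
    have := mul_le_mul_of_nonneg_left hw (by positivity : (0 : ℝ) ≤ (1 / 4) ^ k)
    linarith

/-- The multiplier algebra of the Drury–Arveson space on the ball of `ℂ²` sits strictly
inside `H^∞` of the ball: the inclusion is not bounded below, and consequently some
bounded holomorphic function on the ball is not a multiplier of `H²₂`. -/
theorem stmt11 :
    (∀ c : ℝ, 0 < c →
      ∃ (φ : EuclideanSpace ℂ (Fin 2) → ℂ) (Mn : ℝ),
        DifferentiableOn ℂ φ (ball (0 : EuclideanSpace ℂ (Fin 2)) 1) ∧
        IsDAMultiplier φ ∧ IsLUB (multNormSet φ) Mn ∧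
        ∃ s : ℝ, (∀ w ∈ ball (0 : EuclideanSpace ℂ (Fin 2)) 1, ‖φ w‖ ≤ s) ∧
          s < c * Mn) ∧
    ∃ ψ : EuclideanSpace ℂ (Fin 2) → ℂ,
      DifferentiableOn ℂ ψ (ball (0 : EuclideanSpace ℂ (Fin 2)) 1) ∧
      (∃ C : ℝ, ∀ w ∈ ball (0 : EuclideanSpace ℂ (Fin 2)) 1, ‖ψ w‖ ≤ C) ∧
      ¬ IsDAMultiplier ψ := by
  exact ⟨part_one, part_two⟩
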